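/- Fix strictly increasing α, β : ℚ → ℚ with α x < β x < α (x + ε) for all x and all ε > 0, and let mx be the induced operation. For every n and every near-affine set T ⊆ (Fin n → Bool), the satisfaction set { b : Fin n → ℚ | ∃ t ∈ T, (∀ i j, t i = false → t j = false → b i = b j) ∧ (∀ i j, t i = false → t j = true → b i < b j) } of the min-affine formula with relation T is preserved by mx. -/

import Mathlib

/-- The operation `mx` induced by unary operations `α`, `β`. -/
def mxOp (α β : ℚ → ℚ) : ℚ → ℚ → ℚ :=
  fun x y => if x = y then β x else α (min x y)

/-- `T` is near-affine if `T ∪ {(1,…,1)}` is preserved by `(x, y) ↦ x ⊕ y ⊕ 1`. -/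
def NearAffine {ι : Type*} (T : Set (ι → Bool)) : Prop :=
  ∀ s ∈ T, ∀ s' ∈ T, (fun i => (s i == s' i)) ∈ T ∪ {fun _ => true}

theorem mxOp_comm (α β : ℚ → ℚ) (x y : ℚ) : mxOp α β x y = mxOp α β y x := by
  unfold mxOp
  rw [min_comm]
  by_cases h : x = y
  · simp [h]
  · simp [h, Ne.symm h]

theorem mxOp_self (α β : ℚ → ℚ) (x : ℚ) : mxOp α β x x = β x := by
  simp [mxOp]

theorem mxOp_of_lt (α β : ℚ → ℚ) {x y : ℚ} (h : x < y) : mxOp α β x y = α x := by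
  simp [mxOp, h.ne, h.le]

theorem lt_mxOp {α β : ℚ → ℚ} (hβ : StrictMono β)
    (hαβ : ∀ x ε : ℚ, 0 < ε → α x < β x ∧ β x < α (x + ε))
    {m x y : ℚ} (hx : m < x) (hy : m < y) : β m < mxOp α β x y := by
  unfold mxOp
  split_ifs with h
  · exact hβ hx
  · have := (hαβ m (min x y - m) (sub_pos.2 (lt_min hx hy))).2
    rwa [add_sub_cancel] at this

/-- A tuple satisfies the min-affine constraint at `t` once it is constant on the zero set of `t`
and exceeds that constant elsewhere. -/
theorem constant_on_zeros_and_lt_on_ones {ι : Type*} {t : ι → Bool} {b : ι → ℚ} (c : ℚ)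
    (h₀ : ∀ i, t i = false → b i = c) (h₁ : ∀ i, t i = true → c < b i) :
    (∀ i j, t i = false → t j = false → b i = b j) ∧
      (∀ i j, t i = false → t j = true → b i < b j) :=
  ⟨fun i j hi hj => (h₀ i hi).trans (h₀ j hj).symm, fun i j hi hj => (h₀ i hi).trans_lt (h₁ j hj)⟩

/-- If the minimum `m` of `b`, attained on the zero set of `t`, is below every entry of `b'`, then
the zero set of `t` is also where `mxOp α β (b i) (b' i)` is minimal. -/
theorem mxOp_constant_on_zeros_and_lt_on_ones {ι : Type*} {α β : ℚ → ℚ} (hβ : StrictMono β)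
    (hαβ : ∀ x ε : ℚ, 0 < ε → α x < β x ∧ β x < α (x + ε))
    {t : ι → Bool} {b b' : ι → ℚ} {m : ℚ}
    (h₀ : ∀ i, t i = false → b i = m) (h₁ : ∀ i, t i = true → m < b i) (h' : ∀ i, m < b' i) :
    (∀ i j, t i = false → t j = false → mxOp α β (b i) (b' i) = mxOp α β (b j) (b' j)) ∧
      (∀ i j, t i = false → t j = true → mxOp α β (b i) (b' i) < mxOp α β (b j) (b' j)) := by
  refine constant_on_zeros_and_lt_on_ones (b := fun i => mxOp α β (b i) (b' i)) (α m)
    (fun i hi => ?_) (fun i hi => ?_)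
  · simp only [h₀ i hi, mxOp_of_lt α β (h' i)]
  · exact (hαβ m 1 one_pos).1.trans (lt_mxOp hβ hαβ (h₁ i hi) (h' i))

theorem mx_preserves_min_affine {n : ℕ} (α β : ℚ → ℚ)
    (hα : StrictMono α) (hβ : StrictMono β)
    (hαβ : ∀ x ε : ℚ, 0 < ε → α x < β x ∧ β x < α (x + ε))
    (T : Set (Fin n → Bool)) (hT : NearAffine T) :
    ∀ b ∈ { b : Fin n → ℚ | ∃ t ∈ T,
        (∀ i j, t i = false → t j = false → b i = b j) ∧
        (∀ i j, t i = false → t j = true → b i < b j) },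
      ∀ b' ∈ { b : Fin n → ℚ | ∃ t ∈ T,
          (∀ i j, t i = false → t j = false → b i = b j) ∧
          (∀ i j, t i = false → t j = true → b i < b j) },
        (fun i => mxOp α β (b i) (b' i)) ∈
          { b : Fin n → ℚ | ∃ t ∈ T,
            (∀ i j, t i = false → t j = false → b i = b j) ∧
            (∀ i j, t i = false → t j = true → b i < b j) } := by
  rintro b ⟨t, ht, hb₀, hb₁⟩ b' ⟨t', ht', hb'₀, hb'₁⟩
  by_cases hz : ∀ i, t i = true
  · exact ⟨t, ht, fun i j hi => by simp [hz] at hi, fun i j hi => by simp [hz] at hi⟩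
  by_cases hz' : ∀ i, t' i = true
  · exact ⟨t', ht', fun i j hi => by simp [hz'] at hi, fun i j hi => by simp [hz'] at hi⟩
  simp only [not_forall, Bool.not_eq_true] at hz hz'
  obtain ⟨k, hk⟩ := hz
  obtain ⟨k', hk'⟩ := hz'
  have h₀ : ∀ i, t i = false → b i = b k := fun i hi => hb₀ i k hi hk
  have h₁ : ∀ i, t i = true → b k < b i := fun i => hb₁ k i hk
  have h'₀ : ∀ i, t' i = false → b' i = b' k' := fun i hi => hb'₀ i k' hi hk'
  have h'₁ : ∀ i, t' i = true → b' k' < b' i := fun i => hb'₁ k' i hk'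
  have hle : ∀ i, b k ≤ b i := fun i => by
    cases hi : t i
    exacts [(h₀ i hi).ge, (h₁ i hi).le]
  have hle' : ∀ i, b' k' ≤ b' i := fun i => by
    cases hi : t' i
    exacts [(h'₀ i hi).ge, (h'₁ i hi).le]
  rcases lt_trichotomy (b k) (b' k') with hlt | heq | hgt
  · exact ⟨t, ht, mxOp_constant_on_zeros_and_lt_on_ones hβ hαβ h₀ h₁
      fun i => hlt.trans_le (hle' i)⟩
  · rw [← heq] at h'₀ h'₁
    rcases hT t ht t' ht' with hmem | htrue
    · refine ⟨_, hmem, constant_on_zeros_and_lt_on_ones (α (b k)) (fun i hi => ?_)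
        (fun i hi => ?_)⟩
      · cases hti : t i <;> cases hti' : t' i <;> simp [hti, hti'] at hi
        · rw [h₀ i hti, mxOp_of_lt α β (h'₁ i hti')]
        · rw [h'₀ i hti', mxOp_comm, mxOp_of_lt α β (h₁ i hti)]
      · have hlt := (hαβ (b k) 1 one_pos).1
        cases hti : t i <;> cases hti' : t' i <;> simp [hti, hti'] at hi
        · rwa [h₀ i hti, h'₀ i hti', mxOp_self]
        · exact hlt.trans (lt_mxOp hβ hαβ (h₁ i hti) (h'₁ i hti'))
    · obtain rfl : t = t' := funext fun i => by simpa using congrFun htrue i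
      refine ⟨t, ht, constant_on_zeros_and_lt_on_ones (β (b k)) (fun i hi => ?_)
        (fun i hi => lt_mxOp hβ hαβ (h₁ i hi) (h'₁ i hi))⟩
      rw [h₀ i hi, h'₀ i hi, mxOp_self]
  · simp only [mxOp_comm α β (b _)]
    exact ⟨t', ht', mxOp_constant_on_zeros_and_lt_on_ones hβ hαβ h'₀ h'₁
      fun i => hgt.trans_le (hle i)⟩
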